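/- arXiv:1012.3313 — 2 statements merged into one kernel-verified Lean document; each statement's English description precedes it below -/
import Mathlib

section
/- Let Σ ⊂ ℝ be a nonempty finite set, Q an irreducible stochastic matrix on Σ with invariant distribution μ, and for N ≥ 1 set Q^{(N)} := Id + N^{−γ}(Q − Id). Then μ is also the invariant distribution of Q^{(N)} for every N, and for every β ≥ 0 and h ∈ ℝ, E^{(N)}[F_N(β,h,ω)] → Σ_{x∈Σ} μ(x) F(h + β x) as N → ∞, where E^{(N)} is expectation for the stationary Markov chain ω on Σ with transition matrix Q^{(N)} and initial distribution μ. -/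
open Filter Topology

/-- The contact point `t_i = s_1 + ⋯ + s_i` associated to interarrival times
`s : Fin k → {0,…,N}`. -/
def contacts {k N : ℕ} (s : Fin k → Fin (N + 1)) (i : Fin k) : ℕ :=
  ∑ j ∈ Finset.univ.filter (fun j => j ≤ i), (s j : ℕ)

/-- The constrained homogeneous partition function `Z_{N,u}` (with `Z_{0,u} = 1`). -/
noncomputable def Zhom (K : ℕ → ℝ) (u : ℝ) (N : ℕ) : ℝ :=
  if N = 0 then 1 else
    ∑ k ∈ Finset.Icc 1 N, ∑ s : Fin k → Fin (N + 1),
      if (∀ i, 1 ≤ (s i : ℕ)) ∧ (∑ i, (s i : ℕ)) = N then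
        Real.exp ((k : ℝ) * u) * ∏ i, K (s i : ℕ)
      else 0

/-- The quenched partition function `Z_{N,β,h,ω}`. -/
noncomputable def Zq (K : ℕ → ℝ) (β h : ℝ) (ω : ℕ → ℝ) (N : ℕ) : ℝ :=
  ∑ k ∈ Finset.Icc 1 N, ∑ s : Fin k → Fin (N + 1),
    if (∀ i, 1 ≤ (s i : ℕ)) ∧ (∑ i, (s i : ℕ)) = N then
      Real.exp (∑ i : Fin k, (β * ω (contacts s i) + h)) * ∏ i, K (s i : ℕ)
    else 0

/-- The set of sign-change positions `m ∈ {2,…,N+1}` of `ω` (i.e. `ω_m ≠ ω_{m-1}`):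
the strip endpoints `L_1 < ⋯ < L_{B_N}` are exactly these positions minus one. -/
noncomputable def changeSet (ω : ℕ → ℝ) (N : ℕ) : Finset ℕ :=
  (Finset.Icc 2 (N + 1)).filter fun m => ω m ≠ ω (m - 1)

/-- `B_N`, the number of complete strips between `0` and `N`. -/
noncomputable def BN (ω : ℕ → ℝ) (N : ℕ) : ℕ := (changeSet ω N).card

/-- The strip endpoints: `L_0 = 0` and, for `1 ≤ k ≤ B_N`, `L_k` is the `k`-th
sign-change position of `ω` minus one. -/
noncomputable def Lstrip (ω : ℕ → ℝ) (N : ℕ) (k : ℕ) : ℕ :=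
  if k = 0 then 0 else ((changeSet ω N).sort (· ≤ ·)).getD (k - 1) 0 - 1

/-- The constrained partition function `Z^c_{N,β,h,ω}`: the sum is restricted to
contact sets containing each of the strip endpoints `L_1, …, L_{B_N}`. -/
noncomputable def Zc (K : ℕ → ℝ) (β h : ℝ) (ω : ℕ → ℝ) (N : ℕ) : ℝ :=
  ∑ k ∈ Finset.Icc 1 N, ∑ s : Fin k → Fin (N + 1),
    if (∀ i, 1 ≤ (s i : ℕ)) ∧ (∑ i, (s i : ℕ)) = N ∧
        (∀ m ∈ changeSet ω N, ∃ i : Fin k, contacts s i = m - 1) then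
      Real.exp (∑ i : Fin k, (β * ω (contacts s i) + h)) * ∏ i, K (s i : ℕ)
    else 0

/-- The probability, under the stationary `{-1,+1}`-valued Markov chain `P^{(N)}`
with flip probability `N^{-γ}`, of the trajectory `w` on `{0,…,N+1}`. -/
noncomputable def pathProb (γ : ℝ) (N : ℕ) (w : Fin (N + 2) → Bool) : ℝ :=
  (1 / 2) * ∏ i : Fin (N + 1),
    if w i.castSucc = w i.succ then 1 - (N : ℝ) ^ (-γ) else (N : ℝ) ^ (-γ)

/-- The `±1`-valued sequence associated to a trajectory `w` on `{0,…,N+1}`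
(extended constantly beyond `N+1`; the partition functions at size `N` only
depend on the first `N+2` values). -/
noncomputable def omegaOf (N : ℕ) (w : Fin (N + 2) → Bool) (n : ℕ) : ℝ :=
  if hn : n < N + 2 then (if w ⟨n, hn⟩ then 1 else -1)
  else (if w (Fin.last (N + 1)) then 1 else -1)

/-- The limiting free energy of model B:
`G(β,h) = 0` if `h ≤ -β`, `F(h+β)/2` if `-β < h < β`, and
`(F(h+β) + F(h-β))/2` if `h ≥ β`. -/
noncomputable def Gfun (F : ℝ → ℝ) (β h : ℝ) : ℝ :=
  if h ≤ -β then 0 else if h < β then F (h + β) / 2 else (F (h + β) + F (h - β)) / 2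

/-- Recursive partition function with site weights `exp (u n)`. -/
noncomputable def zrec (K u : ℕ → ℝ) : ℕ → ℝ
  | 0 => 1
  | n + 1 => Real.exp (u (n + 1)) * ∑ m : Fin (n + 1), zrec K u m * K (n + 1 - m)
decreasing_by exact m.2

lemma zrec_zero (K u : ℕ → ℝ) : zrec K u 0 = 1 := by rw [zrec]

lemma zrec_succ (K u : ℕ → ℝ) (n : ℕ) :
    zrec K u (n + 1) =
      Real.exp (u (n + 1)) * ∑ m ∈ Finset.range (n + 1), zrec K u m * K (n + 1 - m) := by
  rw [zrec, Finset.sum_range]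

lemma zrec_eq (K u : ℕ → ℝ) (n : ℕ) (hn : 1 ≤ n) :
    zrec K u n = Real.exp (u n) * ∑ m ∈ Finset.range n, zrec K u m * K (n - m) := by
  obtain ⟨k, rfl⟩ : ∃ k, n = k + 1 := ⟨n - 1, by omega⟩
  exact zrec_succ K u k

lemma zrec_congr (K u v : ℕ → ℝ) (n : ℕ) (h : ∀ i, 1 ≤ i → i ≤ n → u i = v i) :
    zrec K u n = zrec K v n := by
  induction n using Nat.strong_induction_on with
  | _ n ih =>
    rcases Nat.eq_zero_or_pos n with rfl | hn
    · rw [zrec_zero, zrec_zero]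
    · rw [zrec_eq K u n hn, zrec_eq K v n hn, h n hn le_rfl]
      congr 1
      refine Finset.sum_congr rfl fun m hm => ?_
      have hm' := Finset.mem_range.1 hm
      rw [ih m hm' (fun i h1 h2 => h i h1 (by omega))]

lemma zrec_pos (K u : ℕ → ℝ) (hK : ∀ n, 1 ≤ n → 0 < K n) (n : ℕ) : 0 < zrec K u n := by
  induction n using Nat.strong_induction_on with
  | _ n ih =>
    rcases Nat.eq_zero_or_pos n with rfl | hn
    · rw [zrec_zero]; exact one_pos
    · rw [zrec_eq K u n hn]
      refine mul_pos (Real.exp_pos _) (Finset.sum_pos (fun m hm => ?_) ⟨0, by simpa using hn⟩)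
      have hm' := Finset.mem_range.1 hm
      exact mul_pos (ih m hm') (hK _ (by omega))

/-- Fixed number of contacts. -/
noncomputable def Tk (K u : ℕ → ℝ) (N k n : ℕ) : ℝ :=
  ∑ s : Fin k → Fin (N + 1),
    if (∀ i, 1 ≤ (s i : ℕ)) ∧ (∑ i, (s i : ℕ)) = n then
      Real.exp (∑ i : Fin k, u (contacts s i)) * ∏ i, K (s i : ℕ)
    else 0

lemma contacts_snoc_castSucc {k N : ℕ} (s : Fin k → Fin (N + 1)) (x : Fin (N + 1)) (i : Fin k) :
    contacts (Fin.snoc s x : Fin (k + 1) → Fin (N + 1)) i.castSucc = contacts s i := by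
  unfold contacts
  rw [Finset.sum_filter, Finset.sum_filter, Fin.sum_univ_castSucc]
  have h : ¬ (Fin.last k ≤ i.castSucc) := by
    simp [Fin.le_def]
  rw [if_neg h]
  simp

lemma contacts_snoc_last {k N : ℕ} (s : Fin k → Fin (N + 1)) (x : Fin (N + 1)) :
    contacts (Fin.snoc s x : Fin (k + 1) → Fin (N + 1)) (Fin.last k)
      = (∑ i, (s i : ℕ)) + x := by
  unfold contacts
  rw [Finset.sum_filter, Fin.sum_univ_castSucc]
  simp [Fin.le_last]

lemma Tk_zero (K u : ℕ → ℝ) (N n : ℕ) : Tk K u N 0 n = if n = 0 then 1 else 0 := by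
  unfold Tk
  simp [eq_comm]

lemma sum_snoc {A : Type*} [Fintype A] (k : ℕ) (f : (Fin (k + 1) → A) → ℝ) :
    ∑ s, f s = ∑ x : A, ∑ s : Fin k → A, f (Fin.snoc s x : Fin (k + 1) → A) := by
  rw [← (Fin.snocEquiv (fun _ : Fin (k + 1) => A)).sum_comp, Fintype.sum_prod_type]
  rfl

lemma Tk_succ (K u : ℕ → ℝ) (N k n : ℕ) (hn : n ≤ N) :
    Tk K u N (k + 1) n =
      Real.exp (u n) * ∑ m ∈ Finset.range n, Tk K u N k m * K (n - m) := by
  have h1 : Tk K u N (k + 1) n = ∑ x : Fin (N + 1),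
      if 1 ≤ (x : ℕ) ∧ (x : ℕ) ≤ n then
        Real.exp (u n) * (Tk K u N k (n - x) * K x) else 0 := by
    unfold Tk
    rw [sum_snoc]
    refine Finset.sum_congr rfl fun x _ => ?_
    split_ifs with hx
    · rw [Finset.sum_mul, Finset.mul_sum]
      refine Finset.sum_congr rfl fun s _ => ?_
      by_cases hs : (∀ i, 1 ≤ (s i : ℕ)) ∧ (∑ i, (s i : ℕ)) = n - x
      · rw [if_pos hs, if_pos]
        · rw [Fin.sum_univ_castSucc, Fin.prod_univ_castSucc]
          simp only [contacts_snoc_castSucc, contacts_snoc_last, Fin.snoc_castSucc, Fin.snoc_last]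
          rw [hs.2, Nat.sub_add_cancel hx.2, Real.exp_add]
          ring
        · constructor
          · intro i
            refine Fin.lastCases ?_ (fun j => ?_) i
            · simpa using hx.1
            · simpa using hs.1 j
          · rw [Fin.sum_univ_castSucc]
            simp only [Fin.snoc_castSucc, Fin.snoc_last]
            omega
      · rw [if_neg hs, if_neg]
        · simp
        · rintro ⟨h1, h2⟩
          apply hs
          rw [Fin.sum_univ_castSucc] at h2
          simp only [Fin.snoc_castSucc, Fin.snoc_last] at h2
          refine ⟨fun i => ?_, by omega⟩
          simpa using h1 i.castSucc
    · refine Finset.sum_eq_zero fun s _ => ?_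
      rw [if_neg]
      rintro ⟨h1, h2⟩
      apply hx
      rw [Fin.sum_univ_castSucc] at h2
      simp only [Fin.snoc_castSucc, Fin.snoc_last] at h2
      have := h1 (Fin.last k)
      simp only [Fin.snoc_last] at this
      omega
  rw [h1, Fin.sum_univ_eq_sum_range (fun x => if 1 ≤ x ∧ x ≤ n then
        Real.exp (u n) * (Tk K u N k (n - x) * K x) else 0) (N + 1), ← Finset.sum_filter,
    Finset.mul_sum]
  refine Finset.sum_bij' (fun x _ => n - x) (fun m _ => n - m) ?_ ?_ ?_ ?_ ?_
  · intro x hx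
    simp only [Finset.mem_filter, Finset.mem_range] at hx ⊢
    omega
  · intro x hx
    simp only [Finset.mem_filter, Finset.mem_range] at hx ⊢
    omega
  · intro x hx
    simp only [Finset.mem_filter, Finset.mem_range] at hx
    omega
  · intro x hx
    simp only [Finset.mem_range] at hx
    omega
  · intro x hx
    simp only [Finset.mem_filter, Finset.mem_range] at hx
    rw [Nat.sub_sub_self hx.2.2]

lemma Tk_eq_zero (K u : ℕ → ℝ) (N k n : ℕ) (hn : n < k) : Tk K u N k n = 0 := by
  unfold Tk
  refine Finset.sum_eq_zero fun s _ => if_neg ?_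
  rintro ⟨h1, h2⟩
  have : ∑ i : Fin k, 1 ≤ ∑ i, (s i : ℕ) := Finset.sum_le_sum fun i _ => h1 i
  simp at this
  omega

lemma zrec_eq_sum (K u : ℕ → ℝ) (N n : ℕ) (hn : n ≤ N) :
    zrec K u n = ∑ k ∈ Finset.range (N + 1), Tk K u N k n := by
  induction n using Nat.strong_induction_on with
  | _ n ih =>
    rw [Finset.sum_range_succ', Tk_zero]
    rcases Nat.eq_zero_or_pos n with rfl | hn0
    · rw [zrec_zero, Finset.sum_eq_zero]
      · simp
      · intro k _
        exact Tk_eq_zero _ _ _ _ _ (Nat.succ_pos k)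
    · rw [if_neg (by omega), add_zero, zrec_eq K u n hn0]
      simp only [Tk_succ K u N _ n hn]
      rw [← Finset.mul_sum, Finset.sum_comm]
      congr 1
      refine Finset.sum_congr rfl fun m hm => ?_
      have hm' := Finset.mem_range.1 hm
      rw [ih m hm' (by omega), Finset.sum_range_succ, Tk_eq_zero K u N N m (by omega), add_zero,
        Finset.sum_mul]

lemma sum_Icc_Tk (K u : ℕ → ℝ) (N : ℕ) (hN : 1 ≤ N) :
    ∑ k ∈ Finset.Icc 1 N, Tk K u N k N = zrec K u N := by
  rw [zrec_eq_sum K u N N le_rfl, Finset.sum_range_succ', Tk_zero, if_neg (by omega), add_zero]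
  rw [Finset.range_eq_Ico, Finset.sum_Ico_add' (fun k => Tk K u N k N) 0 N 1]
  rfl

lemma Zq_eq (K : ℕ → ℝ) (β h : ℝ) (ω : ℕ → ℝ) (N : ℕ) (hN : 1 ≤ N) :
    Zq K β h ω N = zrec K (fun n => β * ω n + h) N := by
  rw [← sum_Icc_Tk K _ N hN]
  rfl

lemma Zhom_eq (K : ℕ → ℝ) (v : ℝ) (N : ℕ) (hN : 1 ≤ N) :
    Zhom K v N = zrec K (fun _ => v) N := by
  rw [← sum_Icc_Tk K _ N hN, Zhom, if_neg (by omega)]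
  unfold Tk
  simp

/-- Superadditivity. -/
lemma zrec_super (K u : ℕ → ℝ) (hK : ∀ n, 1 ≤ n → 0 < K n) (m n : ℕ) :
    zrec K u m * zrec K (fun i => u (m + i)) n ≤ zrec K u (m + n) := by
  induction n using Nat.strong_induction_on with
  | _ n ih =>
    rcases Nat.eq_zero_or_pos n with rfl | hn
    · rw [zrec_zero]; simp
    · rw [zrec_eq K _ n hn, zrec_eq K u (m + n) (by omega), mul_left_comm]
      refine mul_le_mul_of_nonneg_left ?_ (Real.exp_pos _).le
      rw [Finset.sum_range_add, Finset.mul_sum]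
      have h0 : 0 ≤ ∑ x ∈ Finset.range m, zrec K u x * K (m + n - x) :=
        Finset.sum_nonneg fun x hx => by
          have hm' := Finset.mem_range.1 hx
          exact mul_nonneg (zrec_pos K u hK x).le (hK _ (by omega)).le
      refine le_add_of_nonneg_of_le h0 (Finset.sum_le_sum fun x hx => ?_)
      have hm' := Finset.mem_range.1 hx
      rw [← mul_assoc, Nat.add_sub_add_left]
      exact mul_le_mul_of_nonneg_right (ih x hm') (hK _ (by omega)).le

/-- Quasi-submultiplicativity. -/
lemma zrec_sub (K u : ℕ → ℝ) (hK : ∀ n, 1 ≤ n → 0 < K n) (m N : ℕ) (hm : 1 ≤ m)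
    (D A : ℝ) (hD : 0 ≤ D) (hA : Real.exp (-(u m)) ≤ A)
    (hKD : ∀ a b, 1 ≤ a → 1 ≤ b → a + b ≤ N → K (a + b) ≤ D * (K a * K b))
    (n : ℕ) (hn : m + n ≤ N) :
    zrec K u (m + n) ≤ (1 + D * A) * (zrec K u m * zrec K (fun i => u (m + i)) n) := by
  have hA0 : 0 < A := (Real.exp_pos _).trans_le hA
  have hDA : 1 ≤ 1 + D * A := le_add_of_nonneg_right (mul_nonneg hD hA0.le)
  induction n using Nat.strong_induction_on with
  | _ n ih =>
    have hzm := zrec_pos K u hK m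
    rcases Nat.eq_zero_or_pos n with rfl | hn0
    · rw [zrec_zero]; simp only [add_zero, mul_one]
      exact le_mul_of_one_le_left hzm.le hDA
    · rw [zrec_eq K _ n hn0, zrec_eq K u (m + n) (by omega), mul_left_comm (zrec K u m),
        mul_left_comm (1 + D * A)]
      refine mul_le_mul_of_nonneg_left ?_ (Real.exp_pos _).le
      rw [Finset.sum_range_add]
      obtain ⟨k, rfl⟩ : ∃ k, n = k + 1 := ⟨n - 1, by omega⟩
      have h1 : ∑ x ∈ Finset.range m, zrec K u x * K (m + (k + 1) - x)
          ≤ D * A * zrec K u m * K (k + 1) := by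
        have h2 : ∑ x ∈ Finset.range m, zrec K u x * K (m + (k + 1) - x)
            ≤ D * K (k + 1) * ∑ x ∈ Finset.range m, zrec K u x * K (m - x) := by
          rw [Finset.mul_sum]
          refine Finset.sum_le_sum fun x hx => ?_
          have hm' := Finset.mem_range.1 hx
          have := hKD (m - x) (k + 1) (by omega) (by omega) (by omega)
          rw [show m + (k + 1) - x = m - x + (k + 1) by omega]
          calc _ ≤ zrec K u x * (D * (K (m - x) * K (k + 1))) :=
                mul_le_mul_of_nonneg_left this (zrec_pos K u hK x).le
            _ = _ := by ring
        have h3 : ∑ x ∈ Finset.range m, zrec K u x * K (m - x)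
            = Real.exp (-(u m)) * zrec K u m := by
          rw [zrec_eq K u m hm, ← mul_assoc, ← Real.exp_add]; simp
        rw [h3] at h2
        have hKk := hK (k + 1) (by omega)
        calc _ ≤ _ := h2
          _ ≤ D * K (k + 1) * (A * zrec K u m) := by gcongr
          _ = _ := by ring
      rw [Finset.sum_range_succ', Finset.sum_range_succ', zrec_zero, mul_add, mul_add]
      have h4 : ∑ x ∈ Finset.range k, zrec K u (m + (x + 1)) * K (m + (k + 1) - (m + (x + 1)))
          ≤ (1 + D * A) * (zrec K u m * ∑ x ∈ Finset.range k,
            zrec K (fun i => u (m + i)) (x + 1) * K (k + 1 - (x + 1))) := by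
        rw [Finset.mul_sum, Finset.mul_sum]
        refine Finset.sum_le_sum fun x hx => ?_
        have hm' := Finset.mem_range.1 hx
        rw [Nat.add_sub_add_left, ← mul_assoc, ← mul_assoc, mul_assoc (1 + D * A)]
        exact mul_le_mul_of_nonneg_right (ih (x + 1) (by omega) (by omega)) (hK _ (by omega)).le
      have h5 : zrec K u (m + 0) * K (m + (k + 1) - (m + 0)) = zrec K u m * K (k + 1) := by
        rw [Nat.add_sub_add_left]; simp
      rw [h5]
      simp only [Nat.sub_zero, one_mul]
      linarith

/-- Number of changes. -/
noncomputable def chg (u : ℕ → ℝ) (n : ℕ) : ℝ :=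
  ∑ i ∈ Finset.range n, if u i ≠ u (i + 1) then 1 else 0

lemma chg_nonneg (u : ℕ → ℝ) (n : ℕ) : 0 ≤ chg u n :=
  Finset.sum_nonneg fun i _ => by split_ifs <;> norm_num

lemma chg_lt (u : ℕ → ℝ) (m n : ℕ) (h : m < n) (hu : u m ≠ u (m + 1)) :
    chg u m + 1 ≤ chg u n := by
  have h1 : chg u (m + 1) = chg u m + 1 := by
    unfold chg
    rw [Finset.sum_range_succ, if_pos hu]
  rw [← h1]
  refine Finset.sum_le_sum_of_subset_of_nonneg ?_ ?_
  · intro i; simp only [Finset.mem_range]; omega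
  · intro i _ _; split_ifs <;> norm_num

lemma det_bound (K u : ℕ → ℝ) (hK : ∀ n, 1 ≤ n → 0 < K n) (G : ℝ → ℝ) (ε C E A : ℝ) (N : ℕ)
    (hC : 0 ≤ C) (hE : 0 ≤ E) (hA : ∀ m, Real.exp (-(u m)) ≤ A)
    (hKE : ∀ a b, 1 ≤ a → 1 ≤ b → a + b ≤ N → K (a + b) ≤ E * (K a * K b))
    (hhom : ∀ j l, |Real.log (zrec K (fun _ => u j) l) - l * G (u j)| ≤ ε * l + C)
    (n : ℕ) (hn : n ≤ N) :
    |Real.log (zrec K u n) - ∑ i ∈ Finset.range n, G (u (i + 1))|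
      ≤ ε * n + (chg u n + 1) * (C + Real.log (1 + E * A)) := by
  have hA0 : 0 < A := (Real.exp_pos _).trans_le (hA 0)
  have hDA : 1 ≤ 1 + E * A := le_add_of_nonneg_right (mul_nonneg hE hA0.le)
  have hl := Real.log_nonneg hDA
  induction n using Nat.strong_induction_on with
  | _ n ih =>
    have hex : ∃ m, ∀ i, m < i → i ≤ n → u i = u n := ⟨n, fun i h1 h2 => by omega⟩
    classical
    obtain ⟨m, hm, hmin⟩ : ∃ m, (∀ i, m < i → i ≤ n → u i = u n) ∧
        ∀ k < m, ¬ (∀ i, k < i → i ≤ n → u i = u n) :=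
      ⟨Nat.find hex, Nat.find_spec hex, fun k hk => Nat.find_min hex hk⟩
    have hc := chg_nonneg u n
    rcases Nat.eq_zero_or_pos m with rfl | hm0
    · have h1 : zrec K u n = zrec K (fun _ => u n) n :=
        zrec_congr _ _ _ _ fun i h1 h2 => hm i (by omega) h2
      have h2 : ∑ i ∈ Finset.range n, G (u (i + 1)) = n * G (u n) := by
        rw [Finset.sum_congr rfl (g := fun _ => G (u n))]
        · simp
        · intro i hi
          have := Finset.mem_range.1 hi
          rw [hm (i + 1) (by omega) (by omega)]
      rw [h1, h2]
      refine (hhom n n).trans ?_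
      nlinarith [mul_nonneg hc hC, mul_nonneg hc hl]
    · have hmn : m < n := by
        by_contra hcon
        exact hmin (m - 1) (by omega) fun i h1 h2 => by
          have : i = n := by omega
          rw [this]
      have hne : u m ≠ u n := by
        intro heq
        refine hmin (m - 1) (by omega) fun i h1 h2 => ?_
        rcases Nat.lt_or_ge m i with h | h
        · exact hm i h h2
        · have : i = m := by omega
          rw [this, heq]
      have hch := chg_lt u m n hmn (by rw [hm (m + 1) (by omega) (by omega)]; exact hne)
      obtain ⟨k, rfl⟩ : ∃ k, n = m + k := ⟨n - m, by omega⟩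
      have h1 : zrec K (fun i => u (m + i)) k = zrec K (fun _ => u (m + k)) k :=
        zrec_congr _ _ _ _ fun i h1 h2 => hm (m + i) (by omega) (by omega)
      have h2 : ∑ i ∈ Finset.range (m + k), G (u (i + 1)) =
          ∑ i ∈ Finset.range m, G (u (i + 1)) + k * G (u (m + k)) := by
        rw [Finset.sum_range_add]
        congr 1
        rw [Finset.sum_congr rfl (g := fun _ => G (u (m + k)))]
        · simp
        · intro i hi
          have := Finset.mem_range.1 hi
          rw [hm (m + i + 1) (by omega) (by omega)]
      have hup := zrec_sub K u hK m N hm0 E A hE (hA m) hKE k hn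
      have hlo := zrec_super K u hK m k
      rw [h1] at hup hlo
      have p1 := zrec_pos K u hK m
      have p2 := zrec_pos K (fun _ => u (m + k)) hK k
      have p3 := zrec_pos K u hK (m + k)
      have hup' := Real.log_le_log p3 hup
      have hlo' := Real.log_le_log (mul_pos p1 p2) hlo
      rw [Real.log_mul (by positivity) (by positivity)] at hup'
      rw [Real.log_mul p1.ne' p2.ne'] at hup' hlo'
      have i1 := abs_le.1 (ih m hmn (by omega))
      have i2 := abs_le.1 (hhom (m + k) k)
      rw [h2]
      push_cast
      have h3 : (chg u m + 1) * (C + Real.log (1 + E * A)) + (C + Real.log (1 + E * A))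
          ≤ (chg u (m + k) + 1) * (C + Real.log (1 + E * A)) := by
        nlinarith [mul_nonneg (sub_nonneg.2 hch) (add_nonneg hC hl)]
      rw [abs_le]
      constructor <;> nlinarith [i1.1, i1.2, i2.1, i2.2]

lemma sum_cons' {A : Type*} [Fintype A] (k : ℕ) (f : (Fin (k + 1) → A) → ℝ) :
    ∑ s, f s = ∑ x : A, ∑ s : Fin k → A, f (Fin.cons x s : Fin (k + 1) → A) := by
  rw [← (Fin.consEquiv (fun _ : Fin (k + 1) => A)).sum_comp, Fintype.sum_prod_type]
  rfl

lemma prod_cons {A : Type*} (n : ℕ) (M : A → A → ℝ) (x : A) (w : Fin (n + 1) → A) :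
    ∏ i : Fin (n + 1), M ((Fin.cons x w : Fin (n + 2) → A) i.castSucc)
        ((Fin.cons x w : Fin (n + 2) → A) i.succ)
      = M x (w 0) * ∏ i : Fin n, M (w i.castSucc) (w i.succ) := by
  rw [Fin.prod_univ_succ]
  simp

lemma chain_total {A : Type*} [Fintype A] (M : A → A → ℝ) (hM : ∀ x, ∑ y, M x y = 1) (n : ℕ)
    (ν : A → ℝ) :
    ∑ w : Fin (n + 1) → A, ν (w 0) * ∏ i : Fin n, M (w i.castSucc) (w i.succ) = ∑ x, ν x := by
  induction n generalizing ν with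
  | zero =>
    rw [sum_cons']
    simp
  | succ n ih =>
    rw [sum_cons', Finset.sum_comm]
    simp only [prod_cons, Fin.cons_zero]
    have h := ih (fun y => ∑ x, ν x * M x y)
    rw [Finset.sum_comm] at h
    simp only [← Finset.mul_sum, hM, mul_one] at h
    rw [← h]
    refine Finset.sum_congr rfl fun w _ => ?_
    rw [Finset.sum_mul]
    exact Finset.sum_congr rfl fun x _ => by ring

lemma chain_pair {A : Type*} [Fintype A] (M : A → A → ℝ) (hM : ∀ x, ∑ y, M x y = 1)
    (μ : A → ℝ) (hμ : ∀ y, ∑ x, μ x * M x y = μ y) (φ : A → A → ℝ) (n : ℕ) (i : Fin n) :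
    ∑ w : Fin (n + 1) → A, (μ (w 0) * ∏ i : Fin n, M (w i.castSucc) (w i.succ)) *
      φ (w i.castSucc) (w i.succ) = ∑ x, ∑ y, μ x * M x y * φ x y := by
  induction n with
  | zero => exact i.elim0
  | succ n ih =>
    rw [sum_cons']
    simp only [prod_cons, Fin.cons_zero]
    refine Fin.cases ?_ (fun j => ?_) i
    · simp only [Fin.castSucc_zero, Fin.cons_zero, Fin.cons_succ]
      refine Finset.sum_congr rfl fun x _ => ?_
      rw [← chain_total M hM n (fun y => μ x * M x y * φ x y)]
      exact Finset.sum_congr rfl fun w _ => by ring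
    · rw [← ih j, Finset.sum_comm]
      refine Finset.sum_congr rfl fun w _ => ?_
      simp only [← Fin.succ_castSucc, Fin.cons_succ]
      rw [← hμ (w 0), Finset.sum_mul, Finset.sum_mul]
      exact Finset.sum_congr rfl fun x _ => by ring

lemma chain_marg {A : Type*} [Fintype A] (M : A → A → ℝ) (hM : ∀ x, ∑ y, M x y = 1)
    (μ : A → ℝ) (hμ : ∀ y, ∑ x, μ x * M x y = μ y) (f : A → ℝ) (n : ℕ) (i : Fin n) :
    ∑ w : Fin (n + 1) → A, (μ (w 0) * ∏ i : Fin n, M (w i.castSucc) (w i.succ)) *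
      f (w i.succ) = ∑ x, μ x * f x := by
  rw [chain_pair M hM μ hμ (fun _ y => f y) n i, Finset.sum_comm]
  simp only [← Finset.sum_mul, hμ]

lemma K_poly (α : ℝ) (hα : 0 ≤ α) (L K : ℕ → ℝ)
    (hL : ∀ c : ℝ, 0 < c →
      Tendsto (fun n : ℕ => L ⌊c * (n : ℝ)⌋₊ / L n) atTop (𝓝 1))
    (hKL : ∀ n : ℕ, 1 ≤ n → K n = L n * (n : ℝ) ^ (-(1 + α)))
    (hKpos : ∀ n, 1 ≤ n → 0 < K n) :
    ∃ p : ℕ, ∀ n, 1 ≤ n → K 1 ≤ K n * (n : ℝ) ^ p := by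
  have hLpos : ∀ n, 1 ≤ n → 0 < L n := fun n hn => by
    have h := hKpos n hn
    rw [hKL n hn] at h
    exact pos_of_mul_pos_left h (Real.rpow_nonneg (Nat.cast_nonneg n) _)
  have h2 := (hL (1 / 2) (by norm_num)).eventually (gt_mem_nhds (show (1 : ℝ) < 2 by norm_num))
  obtain ⟨n0, hn0⟩ := eventually_atTop.1 h2
  have hstep : ∀ n, n0 ≤ n → 2 ≤ n → K (n / 2) ≤ 2 * (4 : ℝ) ^ (1 + α) * K n := by
    intro n h1 h2
    have h3 := hn0 n h1
    rw [show ⌊(1 / 2 : ℝ) * (n : ℝ)⌋₊ = n / 2 by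
      rw [show (1 / 2 : ℝ) * (n : ℝ) = (n : ℝ) / ((2 : ℕ) : ℝ) by push_cast; ring,
        Nat.floor_div_natCast, Nat.floor_natCast]] at h3
    have hLn := hLpos n (by omega)
    rw [div_lt_iff₀ hLn] at h3
    rw [hKL n (by omega), hKL (n / 2) (by omega)]
    have hn : (0 : ℝ) < n := by exact_mod_cast (by omega : 0 < n)
    have hn2 : (0 : ℝ) < ((n / 2 : ℕ) : ℝ) := by exact_mod_cast (by omega : 0 < n / 2)
    have hle : (n : ℝ) ≤ 4 * ((n / 2 : ℕ) : ℝ) := by exact_mod_cast (by omega : n ≤ 4 * (n / 2))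
    have h4 : ((n / 2 : ℕ) : ℝ) ^ (-(1 + α)) ≤ (4 : ℝ) ^ (1 + α) * (n : ℝ) ^ (-(1 + α)) := by
      rw [Real.rpow_neg hn2.le, Real.rpow_neg hn.le, ← div_eq_mul_inv, inv_eq_one_div,
        div_le_div_iff₀ (Real.rpow_pos_of_pos hn2 _) (Real.rpow_pos_of_pos hn _), one_mul,
        ← Real.mul_rpow (by norm_num) hn2.le]
      exact Real.rpow_le_rpow hn.le hle (by linarith)
    calc L (n / 2) * ((n / 2 : ℕ) : ℝ) ^ (-(1 + α))
        ≤ (2 * L n) * ((4 : ℝ) ^ (1 + α) * (n : ℝ) ^ (-(1 + α))) :=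
          mul_le_mul h3.le h4 (Real.rpow_nonneg hn2.le _) (by positivity)
      _ = _ := by ring
  have hM : ∃ M : ℝ, ∀ n, 2 ≤ n → K (n / 2) ≤ M * K n := by
    refine ⟨2 * (4 : ℝ) ^ (1 + α) + ∑ n ∈ Finset.Ico 2 n0, K (n / 2) / K n, fun n hn => ?_⟩
    have hKn := hKpos n (by omega)
    have hpos : ∀ m ∈ Finset.Ico 2 n0, 0 ≤ K (m / 2) / K m := fun m hm => by
      have hm' := Finset.mem_Ico.1 hm
      exact (div_pos (hKpos _ (by omega)) (hKpos _ (by omega))).le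
    rcases Nat.lt_or_ge n n0 with h | h
    · have := Finset.single_le_sum hpos (Finset.mem_Ico.2 ⟨hn, h⟩)
      rw [div_le_iff₀ hKn] at this
      refine this.trans (mul_le_mul_of_nonneg_right ?_ hKn.le)
      have : (0 : ℝ) ≤ 2 * (4 : ℝ) ^ (1 + α) := by positivity
      linarith
    · refine (hstep n h hn).trans (mul_le_mul_of_nonneg_right ?_ hKn.le)
      have := Finset.sum_nonneg hpos
      linarith
  obtain ⟨M, hM⟩ := hM
  obtain ⟨p, hp⟩ := pow_unbounded_of_one_lt M (show (1 : ℝ) < 2 by norm_num)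
  refine ⟨p, fun n => ?_⟩
  induction n using Nat.strong_induction_on with
  | _ n ih =>
    intro hn
    rcases Nat.lt_or_ge n 2 with h | h
    · have : n = 1 := by omega
      subst this; simp
    · have h1 := ih (n / 2) (by omega) (by omega)
      have hKn := hKpos n hn
      have hle : ((n / 2 : ℕ) : ℝ) * 2 ≤ n := by exact_mod_cast (by omega : n / 2 * 2 ≤ n)
      calc K 1 ≤ K (n / 2) * ((n / 2 : ℕ) : ℝ) ^ p := h1
        _ ≤ (2 ^ p * K n) * ((n / 2 : ℕ) : ℝ) ^ p := by
          refine mul_le_mul_of_nonneg_right ((hM n h).trans ?_) (by positivity)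
          exact mul_le_mul_of_nonneg_right hp.le hKn.le
        _ = K n * (((n / 2 : ℕ) : ℝ) * 2) ^ p := by rw [mul_pow]; ring
        _ ≤ _ := by gcongr

lemma K_le_one (K : ℕ → ℝ) (hKpos : ∀ n, 1 ≤ n → 0 < K n) (hKsum : ∑' n : ℕ, K (n + 1) = 1)
    (n : ℕ) (hn : 1 ≤ n) : K n ≤ 1 := by
  have hs : Summable fun n : ℕ => K (n + 1) := by
    by_contra h
    rw [tsum_eq_zero_of_not_summable h] at hKsum
    norm_num at hKsum
  rw [← hKsum]
  have := hs.le_tsum (n - 1) (fun j _ => (hKpos (j + 1) (by omega)).le)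
  rwa [Nat.sub_add_cancel hn] at this

lemma hom_bound (K : ℕ → ℝ) (v f : ℝ)
    (hF : Tendsto (fun N : ℕ => Real.log (Zhom K v N) / N) atTop (𝓝 f)) (ε : ℝ) (hε : 0 < ε) :
    ∃ C : ℝ, 0 ≤ C ∧ ∀ l : ℕ, |Real.log (zrec K (fun _ => v) l) - l * f| ≤ ε * l + C := by
  obtain ⟨n0, hn0⟩ := (Metric.tendsto_atTop.1 hF) ε hε
  refine ⟨∑ l ∈ Finset.range (n0 + 1), |Real.log (zrec K (fun _ => v) l) - l * f|,
    Finset.sum_nonneg fun _ _ => abs_nonneg _, fun l => ?_⟩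
  rcases Nat.lt_or_ge l (n0 + 1) with h | h
  · have := Finset.single_le_sum (f := fun l : ℕ => |Real.log (zrec K (fun _ => v) l) - l * f|)
      (fun _ _ => abs_nonneg _) (Finset.mem_range.2 h)
    have h2 : 0 ≤ ε * l := by positivity
    linarith
  · have h1 := hn0 l (by omega)
    have hl : (0 : ℝ) < l := by exact_mod_cast (by omega : 0 < l)
    rw [Real.dist_eq, Zhom_eq K v l (by omega)] at h1
    have h2 : Real.log (zrec K (fun _ => v) l) - l * f
        = (Real.log (zrec K (fun _ => v) l) / l - f) * l := by field_simp
    have h3 : 0 ≤ ∑ l ∈ Finset.range (n0 + 1), |Real.log (zrec K (fun _ => v) l) - l * f| :=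
      Finset.sum_nonneg fun _ _ => abs_nonneg _
    have h4 : |Real.log (zrec K (fun _ => v) l) - l * f| ≤ ε * l := by
      rw [h2, abs_mul, abs_of_pos hl]
      exact mul_le_mul_of_nonneg_right h1.le hl.le
    linarith

lemma err_tendsto (γ c p : ℝ) (hγ0 : 0 < γ) :
    Tendsto (fun N : ℕ => 2 * ((N : ℝ) ^ (-γ) * (c + p * Real.log N))) atTop (𝓝 0) := by
  have h1 : Tendsto (fun x : ℝ => x ^ (-γ)) atTop (𝓝 0) := tendsto_rpow_neg_atTop hγ0
  have h2 : Tendsto (fun x : ℝ => x ^ (-γ) * Real.log x) atTop (𝓝 0) := by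
    have := (isLittleO_log_rpow_atTop hγ0).tendsto_div_nhds_zero
    refine this.congr' ?_
    filter_upwards [eventually_gt_atTop 0] with x hx
    rw [Real.rpow_neg hx.le]; field_simp
  have h3 : Tendsto (fun x : ℝ => 2 * (x ^ (-γ) * (c + p * Real.log x))) atTop (𝓝 0) := by
    have := ((h1.mul_const c).add (h2.mul_const p)).const_mul 2
    simp only [zero_mul, add_zero, mul_zero] at this
    refine this.congr fun x => ?_
    ring
  exact h3.comp tendsto_natCast_atTop_atTop

lemma QN_row {A : Type*} [Fintype A] [DecidableEq A] (Q : Matrix A A ℝ)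
    (hQ1 : ∀ x, ∑ y, Q x y = 1) (t : ℝ) (x : A) :
    ∑ y, ((1 : Matrix A A ℝ) + t • (Q - 1)) x y = 1 := by
  simp only [Matrix.add_apply, Matrix.smul_apply, Matrix.sub_apply, smul_eq_mul,
    Finset.sum_add_distrib, ← Finset.mul_sum, Finset.sum_sub_distrib, hQ1]
  simp [Matrix.one_apply]

lemma QN_inv {A : Type*} [Fintype A] [DecidableEq A] (Q : Matrix A A ℝ) (μ : A → ℝ)
    (hμinv : ∀ y, ∑ x, μ x * Q x y = μ y) (t : ℝ) (y : A) :
    ∑ x, μ x * ((1 : Matrix A A ℝ) + t • (Q - 1)) x y = μ y := by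
  have h1 : ∑ x, μ x * (1 : Matrix A A ℝ) x y = μ y := by simp [Matrix.one_apply]
  have h2 : ∀ x, μ x * ((1 : Matrix A A ℝ) + t • (Q - 1)) x y =
      μ x * (1 : Matrix A A ℝ) x y + t * (μ x * Q x y - μ x * (1 : Matrix A A ℝ) x y) := by
    intro x
    simp only [Matrix.add_apply, Matrix.smul_apply, Matrix.sub_apply, smul_eq_mul]
    ring
  simp only [h2, Finset.sum_add_distrib, ← Finset.mul_sum, Finset.sum_sub_distrib, h1, hμinv]
  ring

lemma QN_nonneg {A : Type*} [Fintype A] [DecidableEq A] (Q : Matrix A A ℝ)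
    (hQ0 : ∀ x y, 0 ≤ Q x y) (t : ℝ) (ht0 : 0 ≤ t) (ht1 : t ≤ 1) (x y : A) :
    0 ≤ ((1 : Matrix A A ℝ) + t • (Q - 1)) x y := by
  simp only [Matrix.add_apply, Matrix.smul_apply, Matrix.sub_apply, smul_eq_mul]
  have h1 : 0 ≤ (1 : Matrix A A ℝ) x y := by
    rw [Matrix.one_apply]; split_ifs <;> norm_num
  nlinarith [mul_nonneg ht0 (hQ0 x y), mul_nonneg (sub_nonneg.2 ht1) h1]

lemma QN_off {A : Type*} [Fintype A] [DecidableEq A] (Q : Matrix A A ℝ)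
    (hQ0 : ∀ x y, 0 ≤ Q x y) (hQ1 : ∀ x, ∑ y, Q x y = 1) (μ : A → ℝ) (hμ0 : ∀ x, 0 ≤ μ x)
    (hμ1 : ∑ x, μ x = 1) (t : ℝ) (ht0 : 0 ≤ t) :
    ∑ x, ∑ y, μ x * ((1 : Matrix A A ℝ) + t • (Q - 1)) x y * (if x ≠ y then 1 else 0) ≤ t := by
  calc _ ≤ ∑ x, ∑ y, μ x * (t * Q x y) := by
        refine Finset.sum_le_sum fun x _ => Finset.sum_le_sum fun y _ => ?_
        by_cases hxy : x = y
        · simp only [hxy, ne_eq, not_true_eq_false, if_false, mul_zero]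
          exact mul_nonneg (hμ0 _) (mul_nonneg ht0 (hQ0 _ _))
        · simp [hxy]
    _ = t := by
        simp only [← Finset.mul_sum, hQ1, mul_one, ← Finset.sum_mul, hμ1, one_mul]

/-- The environment attached to a trajectory. -/
noncomputable def env {S : Finset ℝ} (N : ℕ) (w : Fin (N + 2) → S) (n : ℕ) : ℝ :=
  if hn : n < N + 2 then ((w ⟨n, hn⟩ : ℝ)) else ((w (Fin.last (N + 1)) : ℝ))

lemma env_mem {S : Finset ℝ} (N : ℕ) (w : Fin (N + 2) → S) (n : ℕ) :
    ∃ x : S, env N w n = x := by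
  unfold env
  split_ifs with h
  · exact ⟨_, rfl⟩
  · exact ⟨_, rfl⟩

lemma env_castSucc {S : Finset ℝ} (N : ℕ) (w : Fin (N + 2) → S) (i : Fin (N + 1)) :
    env N w i = w i.castSucc := by
  unfold env
  rw [dif_pos (by omega)]
  rfl

lemma env_succ {S : Finset ℝ} (N : ℕ) (w : Fin (N + 2) → S) (i : Fin (N + 1)) :
    env N w (i + 1) = w i.succ := by
  unfold env
  rw [dif_pos (by omega)]
  rfl

lemma avg_bound {S : Finset ℝ} (p : ℕ) (K : ℕ → ℝ) (hKpos : ∀ n, 1 ≤ n → 0 < K n)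
    (hK1 : ∀ n, 1 ≤ n → K n ≤ 1) (hp : ∀ n, 1 ≤ n → K 1 ≤ K n * (n : ℝ) ^ p)
    (F : ℝ → ℝ) (β h ε C A : ℝ) (hC : 0 ≤ C)
    (hA : ∀ x : S, Real.exp (-(β * x + h)) ≤ A)
    (hhom : ∀ (x : S) (l : ℕ),
      |Real.log (zrec K (fun _ => β * x + h) l) - l * F (β * x + h)| ≤ ε * l + C)
    (M : S → S → ℝ) (hM0 : ∀ x y, 0 ≤ M x y) (hM1 : ∀ x, ∑ y, M x y = 1)
    (μ : S → ℝ) (hμ0 : ∀ x, 0 ≤ μ x) (hμ1 : ∑ x, μ x = 1)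
    (hμ : ∀ y, ∑ x, μ x * M x y = μ y) (t : ℝ)
    (hoff : ∑ x, ∑ y, μ x * M x y * (if x ≠ y then 1 else 0) ≤ t) (N : ℕ) (hN : 1 ≤ N) :
    |∑ w : Fin (N + 2) → S, (μ (w 0) * ∏ i : Fin (N + 1), M (w i.castSucc) (w i.succ)) *
        (Real.log (Zq K β h (env N w) N) / N) - ∑ x, μ x * F (h + β * x)| ≤
      ε + (N * t + 1) * (C + Real.log (1 + (N : ℝ) ^ (2 * p) / K 1 ^ 2 * A)) / N := by
  have hN' : (0 : ℝ) < N := by exact_mod_cast hN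
  have hKone := hKpos 1 le_rfl
  set P : (Fin (N + 2) → S) → ℝ := fun w =>
    μ (w 0) * ∏ i : Fin (N + 1), M (w i.castSucc) (w i.succ) with hP
  have hP0 : ∀ w, 0 ≤ P w := fun w =>
    mul_nonneg (hμ0 _) (Finset.prod_nonneg fun i _ => hM0 _ _)
  have hP1 : ∑ w, P w = 1 := by rw [hP, chain_total M hM1 (N + 1) μ, hμ1]
  set U : (Fin (N + 2) → S) → ℕ → ℝ := fun w n => β * env N w n + h with hU
  set E : ℝ := (N : ℝ) ^ (2 * p) / K 1 ^ 2 with hE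
  have hE0 : 0 ≤ E := by positivity
  have hKE : ∀ a b, 1 ≤ a → 1 ≤ b → a + b ≤ N → K (a + b) ≤ E * (K a * K b) := by
    intro a b ha hb hab
    have h1 : ∀ a, 1 ≤ a → a ≤ N → K 1 ≤ K a * (N : ℝ) ^ p := fun a ha haN => by
      have hKa := hKpos a ha
      refine (hp a ha).trans ?_
      gcongr
    refine (hK1 (a + b) (by omega)).trans ?_
    have h2 := mul_le_mul (h1 a ha (by omega)) (h1 b hb (by omega)) hKone.le
      (mul_nonneg (hKpos a ha).le (by positivity))
    rw [hE, div_mul_eq_mul_div, le_div_iff₀ (by positivity)]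
    calc 1 * K 1 ^ 2 = K 1 * K 1 := by ring
      _ ≤ _ := h2
      _ = _ := by ring
  have hdet : ∀ w, |Real.log (zrec K (U w) N) - ∑ i ∈ Finset.range N, F (U w (i + 1))|
      ≤ ε * N + (chg (U w) N + 1) * (C + Real.log (1 + E * A)) := by
    intro w
    refine det_bound K (U w) hKpos F ε C E A N hC hE0 ?_ hKE ?_ N le_rfl
    · intro m
      obtain ⟨x, hx⟩ := env_mem N w m
      simp only [hU, hx]
      exact hA x
    · intro j l
      obtain ⟨x, hx⟩ := env_mem N w j
      simp only [hU, hx]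
      exact hhom x l
  have hAne : 0 < A := by
    obtain ⟨w, -, -⟩ : ∃ w ∈ Finset.univ, P w ≠ 0 := by
      by_contra hcon
      push Not at hcon
      rw [Finset.sum_eq_zero hcon] at hP1
      norm_num at hP1
    exact (Real.exp_pos _).trans_le (hA (w 0))
  have hR : 0 ≤ C + Real.log (1 + E * A) :=
    add_nonneg hC (Real.log_nonneg (le_add_of_nonneg_right (mul_nonneg hE0 hAne.le)))
  have hmean : ∑ w, P w * ∑ i ∈ Finset.range N, F (U w (i + 1))
      = N * ∑ x, μ x * F (h + β * x) := by
    simp only [Finset.mul_sum]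
    rw [Finset.sum_comm, Finset.sum_congr rfl (g := fun _ => ∑ x, μ x * F (h + β * x))]
    · simp [Finset.mul_sum]
    · intro i hi
      have hi' := Finset.mem_range.1 hi
      rw [← chain_marg M hM1 μ hμ (fun x => F (h + β * x)) (N + 1) ⟨i, by omega⟩]
      refine Finset.sum_congr rfl fun w _ => ?_
      have := env_succ N w ⟨i, by omega⟩
      simp only at this
      simp only [hP, hU, this, add_comm h]
  have hchg : ∑ w, P w * chg (U w) N ≤ N * t := by
    unfold chg
    simp only [Finset.mul_sum]
    rw [Finset.sum_comm]
    calc _ ≤ ∑ i ∈ Finset.range N, t := by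
          refine Finset.sum_le_sum fun i hi => ?_
          have hi' := Finset.mem_range.1 hi
          refine le_trans ?_ hoff
          rw [← chain_pair M hM1 μ hμ (fun x y => if x ≠ y then 1 else 0) (N + 1) ⟨i, by omega⟩]
          refine Finset.sum_le_sum fun w _ => mul_le_mul_of_nonneg_left ?_ (hP0 w)
          have e1 := env_castSucc N w ⟨i, by omega⟩
          have e2 := env_succ N w ⟨i, by omega⟩
          simp only at e1 e2
          simp only [hU, e1, e2]
          by_cases hw : w (Fin.castSucc ⟨i, by omega⟩) = w (Fin.succ ⟨i, by omega⟩)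
          · rw [hw]; simp only [ne_eq, not_true_eq_false, if_false, le_refl]
          · rw [if_pos hw]
            split_ifs <;> norm_num
      _ = N * t := by simp
  have key : ∑ w, P w * (Real.log (Zq K β h (env N w) N) / N) - ∑ x, μ x * F (h + β * x)
      = (∑ w, P w * (Real.log (zrec K (U w) N) -
          ∑ i ∈ Finset.range N, F (U w (i + 1)))) / N := by
    simp only [mul_sub, Finset.sum_sub_distrib]
    rw [hmean, sub_div, mul_div_cancel_left₀ _ hN'.ne', Finset.sum_div]
    congr 1
    refine Finset.sum_congr rfl fun w _ => ?_
    rw [Zq_eq K β h _ N hN, mul_div_assoc]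
  rw [key, abs_div, abs_of_pos hN', div_le_iff₀ hN']
  calc _ ≤ ∑ w, P w * (ε * N + (chg (U w) N + 1) * (C + Real.log (1 + E * A))) := by
        refine (Finset.abs_sum_le_sum_abs _ _).trans (Finset.sum_le_sum fun w _ => ?_)
        rw [abs_mul, abs_of_nonneg (hP0 w)]
        exact mul_le_mul_of_nonneg_left (hdet w) (hP0 w)
    _ = (∑ w, P w) * (ε * N) + (∑ w, P w * chg (U w) N + ∑ w, P w) *
          (C + Real.log (1 + E * A)) := by
        rw [← Finset.sum_add_distrib, Finset.sum_mul, Finset.sum_mul, ← Finset.sum_add_distrib]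
        exact Finset.sum_congr rfl fun w _ => by ring
    _ ≤ 1 * (ε * N) + (N * t + 1) * (C + Real.log (1 + E * A)) := by
        rw [hP1]
        gcongr
    _ = _ := by field_simp

/-- Let `S ⊂ ℝ` be a nonempty finite set, `Q` an irreducible
stochastic matrix on `S` with invariant distribution `μ`, and
`Q^{(N)} = Id + N^{-γ}(Q - Id)`.  Then `μ` is invariant for every `Q^{(N)}`,
and for every `β ≥ 0` and `h`, the averaged quenched free energy under the
stationary chain with transition matrix `Q^{(N)}` converges to
`∑_{x ∈ S} μ(x) F(h + βx)`. -/
theorem statement15 (α : ℝ) (hα : 0 ≤ α) (L K : ℕ → ℝ)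
    (hL : ∀ c : ℝ, 0 < c →
      Tendsto (fun n : ℕ => L ⌊c * (n : ℝ)⌋₊ / L n) atTop (𝓝 1))
    (hKL : ∀ n : ℕ, 1 ≤ n → K n = L n * (n : ℝ) ^ (-(1 + α)))
    (hKpos : ∀ n, 1 ≤ n → 0 < K n) (hKsum : ∑' n : ℕ, K (n + 1) = 1)
    (γ : ℝ) (hγ0 : 0 < γ) (hγ1 : γ < 1)
    (F : ℝ → ℝ)
    (hF : ∀ u : ℝ, Tendsto (fun N : ℕ => Real.log (Zhom K u N) / N) atTop (𝓝 (F u)))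
    (S : Finset ℝ) (hS : S.Nonempty)
    (Q : Matrix S S ℝ) (hQ0 : ∀ x y, 0 ≤ Q x y) (hQ1 : ∀ x, ∑ y, Q x y = 1)
    (hQirr : ∀ x y : S, ∃ t, 1 ≤ t ∧ 0 < (Q ^ t) x y)
    (μ : S → ℝ) (hμ0 : ∀ x, 0 ≤ μ x) (hμ1 : ∑ x, μ x = 1)
    (hμinv : ∀ y : S, ∑ x, μ x * Q x y = μ y) :
    (∀ N : ℕ, 1 ≤ N → ∀ y : S,
      ∑ x, μ x * ((1 : Matrix S S ℝ) + (N : ℝ) ^ (-γ) • (Q - 1)) x y = μ y) ∧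
    ∀ β : ℝ, 0 ≤ β → ∀ h : ℝ,
      Tendsto (fun N : ℕ => ∑ w : Fin (N + 2) → S,
          (μ (w 0) * ∏ i : Fin (N + 1),
            ((1 : Matrix S S ℝ) + (N : ℝ) ^ (-γ) • (Q - 1)) (w i.castSucc) (w i.succ)) *
          (Real.log (Zq K β h
            (fun n => if hn : n < N + 2 then ((w ⟨n, hn⟩ : ℝ)) else ((w (Fin.last (N + 1)) : ℝ)))
            N) / N))
        atTop (𝓝 (∑ x : S, μ x * F (h + β * x))) := by
  refine ⟨fun N _ y => QN_inv Q μ hμinv _ y, fun β _ h => ?_⟩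
  obtain ⟨p, hp⟩ := K_poly α hα L K hL hKL hKpos
  have hK1 := K_le_one K hKpos hKsum
  have hKone := hKpos 1 le_rfl
  set A : ℝ := ∑ x : S, Real.exp (-(β * x + h)) with hAdef
  have hA : ∀ x : S, Real.exp (-(β * x + h)) ≤ A := fun x =>
    Finset.single_le_sum (f := fun x : S => Real.exp (-(β * x + h)))
      (fun _ _ => (Real.exp_pos _).le) (Finset.mem_univ x)
  have hA0 : 0 ≤ A := Finset.sum_nonneg fun _ _ => (Real.exp_pos _).le
  rw [Metric.tendsto_atTop]
  intro δ hδ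
  have hb := fun x : S => hom_bound K (β * x + h) (F (β * x + h)) (hF _) (δ / 2) (half_pos hδ)
  choose Cx hCx0 hCx using hb
  set C : ℝ := ∑ x : S, Cx x with hCdef
  have hC0 : 0 ≤ C := Finset.sum_nonneg fun x _ => hCx0 x
  have hC : ∀ x, Cx x ≤ C := fun x =>
    Finset.single_le_sum (fun x _ => hCx0 x) (Finset.mem_univ x)
  set c : ℝ := C + Real.log (1 + A / K 1 ^ 2) with hc
  have herr := (err_tendsto γ c (2 * p : ℕ) hγ0).eventually (gt_mem_nhds (half_pos hδ))
  obtain ⟨n0, hn0⟩ := eventually_atTop.1 herr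
  refine ⟨n0 + 1, fun N hN => ?_⟩
  have hN1 : 1 ≤ N := by omega
  have hN' : (1 : ℝ) ≤ N := by exact_mod_cast hN1
  have ht0 : 0 ≤ (N : ℝ) ^ (-γ) := Real.rpow_nonneg (by linarith) _
  have ht1 : (N : ℝ) ^ (-γ) ≤ 1 := Real.rpow_le_one_of_one_le_of_nonpos hN' (by linarith)
  have hmain := avg_bound p K hKpos hK1 hp F β h (δ / 2) C A hC0 hA
    (fun x l => (hCx x l).trans (by linarith [hC x]))
    ((1 : Matrix S S ℝ) + (N : ℝ) ^ (-γ) • (Q - 1) : Matrix S S ℝ) (QN_nonneg Q hQ0 _ ht0 ht1)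
    (QN_row Q hQ1 _) μ hμ0 hμ1 (QN_inv Q μ hμinv _) ((N : ℝ) ^ (-γ))
    (QN_off Q hQ0 hQ1 μ hμ0 hμ1 _ ht0) N hN1
  rw [Real.dist_eq]
  refine lt_of_le_of_lt hmain ?_
  have hNg : 1 ≤ (N : ℝ) * (N : ℝ) ^ (-γ) := by
    have : (N : ℝ) * (N : ℝ) ^ (-γ) = (N : ℝ) ^ (1 - γ) := by
      rw [sub_eq_add_neg, Real.rpow_add (by linarith), Real.rpow_one]
    rw [this]
    exact Real.one_le_rpow hN' (by linarith)
  have hlog : C + Real.log (1 + (N : ℝ) ^ (2 * p) / K 1 ^ 2 * A)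
      ≤ c + (2 * p : ℕ) * Real.log N := by
    have hpw : (1 : ℝ) ≤ (N : ℝ) ^ (2 * p) := one_le_pow₀ hN'
    have h1 : 1 + (N : ℝ) ^ (2 * p) / K 1 ^ 2 * A ≤ (1 + A / K 1 ^ 2) * (N : ℝ) ^ (2 * p) := by
      have : (N : ℝ) ^ (2 * p) / K 1 ^ 2 * A = A / K 1 ^ 2 * (N : ℝ) ^ (2 * p) := by ring
      rw [this]
      linarith
    have h2 := Real.log_le_log (by positivity) h1
    rw [Real.log_mul (by positivity) (by positivity), Real.log_pow] at h2
    rw [hc]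
    linarith
  have hlog0 : 0 ≤ C + Real.log (1 + (N : ℝ) ^ (2 * p) / K 1 ^ 2 * A) :=
    add_nonneg hC0 (Real.log_nonneg (le_add_of_nonneg_right (by positivity)))
  have h3 : (N * (N : ℝ) ^ (-γ) + 1) *
      (C + Real.log (1 + (N : ℝ) ^ (2 * p) / K 1 ^ 2 * A)) / N
      ≤ 2 * ((N : ℝ) ^ (-γ) * (c + (2 * p : ℕ) * Real.log N)) := by
    rw [div_le_iff₀ (by linarith)]
    calc _ ≤ (N * (N : ℝ) ^ (-γ) + N * (N : ℝ) ^ (-γ)) * (c + (2 * p : ℕ) * Real.log N) :=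
          mul_le_mul (by linarith) hlog hlog0 (by linarith)
      _ = _ := by ring
  have h4 := hn0 N (by omega)
  linarith
end

section
/- The homogeneous pinning model with recurrent interarrival law has critical point zero: F(u) = 0 for every u ≤ 0, and F(u) > 0 for every u > 0. -/
open Filter Topology

theorem aux_term_nonneg (K : ℕ → ℝ) (hKpos : ∀ n, 1 ≤ n → 0 < K n) (u : ℝ) (N k : ℕ)
    (s : Fin k → Fin (N + 1)) :
    0 ≤ (if (∀ i, 1 ≤ (s i : ℕ)) ∧ (∑ i, (s i : ℕ)) = N then
        Real.exp ((k : ℝ) * u) * ∏ i, K (s i : ℕ) else 0) := by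
  split_ifs with h
  · exact mul_nonneg (Real.exp_pos _).le (Finset.prod_nonneg fun i _ => (hKpos _ (h.1 i)).le)
  · exact le_rfl

theorem aux_lower_one (K : ℕ → ℝ) (hKpos : ∀ n, 1 ≤ n → 0 < K n) (u : ℝ) (N : ℕ) (hN : 1 ≤ N) :
    Real.exp u * K N ≤ Zhom K u N := by
  rw [Zhom, if_neg (by omega)]
  have h1 : (1 : ℕ) ∈ Finset.Icc 1 N := Finset.mem_Icc.2 ⟨le_rfl, hN⟩
  refine le_trans ?_ (Finset.single_le_sum (f := fun k => ∑ s : Fin k → Fin (N + 1),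
      if (∀ i, 1 ≤ (s i : ℕ)) ∧ (∑ i, (s i : ℕ)) = N then
        Real.exp ((k : ℝ) * u) * ∏ i, K (s i : ℕ) else 0)
    (fun k _ => Finset.sum_nonneg fun s _ => aux_term_nonneg K hKpos u N k s) h1)
  refine le_trans ?_ (Finset.single_le_sum (f := fun s : Fin 1 → Fin (N + 1) =>
      if (∀ i, 1 ≤ (s i : ℕ)) ∧ (∑ i, (s i : ℕ)) = N then
        Real.exp (((1 : ℕ) : ℝ) * u) * ∏ i, K (s i : ℕ) else 0)
    (fun s _ => aux_term_nonneg K hKpos u N 1 s) (Finset.mem_univ (fun _ => Fin.last N)))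
  simp [hN]

theorem aux_partial_le (K : ℕ → ℝ) (hKpos : ∀ n, 1 ≤ n → 0 < K n)
    (hs : HasSum (fun n => K (n + 1)) 1) (N : ℕ) :
    ∑ x : Fin (N + 1), (if 1 ≤ (x : ℕ) then K (x : ℕ) else 0) ≤ 1 := by
  rw [Fin.sum_univ_eq_sum_range (fun n => if 1 ≤ n then K n else 0) (N + 1),
    Finset.sum_range_succ']
  have h : ∀ n : ℕ, (if 1 ≤ n + 1 then K (n + 1) else 0) = K (n + 1) :=
    fun n => if_pos (by omega)
  simp only [h]
  rw [if_neg (by omega), add_zero]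
  exact sum_le_hasSum _ (fun n _ => (hKpos _ (by omega)).le) hs

theorem aux_upper (K : ℕ → ℝ) (hKpos : ∀ n, 1 ≤ n → 0 < K n)
    (hs : HasSum (fun n => K (n + 1)) 1) (u : ℝ) (hu : u ≤ 0) (N : ℕ) (hN : 1 ≤ N) :
    Zhom K u N ≤ N := by
  rw [Zhom, if_neg (by omega)]
  have key : ∀ k ∈ Finset.Icc 1 N, (∑ s : Fin k → Fin (N + 1),
      if (∀ i, 1 ≤ (s i : ℕ)) ∧ (∑ i, (s i : ℕ)) = N then
        Real.exp ((k : ℝ) * u) * ∏ i, K (s i : ℕ) else 0) ≤ 1 := by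
    intro k _
    have hg : ∀ n : ℕ, 0 ≤ (if 1 ≤ n then K n else 0) := by
      intro n
      split_ifs with h
      · exact (hKpos n h).le
      · exact le_rfl
    calc _ ≤ ∑ s : Fin k → Fin (N + 1), ∏ i, (if 1 ≤ (s i : ℕ) then K (s i : ℕ) else 0) := by
          refine Finset.sum_le_sum fun s _ => ?_
          split_ifs with h
          · have : ∏ i, (if 1 ≤ (s i : ℕ) then K (s i : ℕ) else 0) = ∏ i, K (s i : ℕ) :=
              Finset.prod_congr rfl fun i _ => if_pos (h.1 i)
            rw [this]
            have h0 : 0 ≤ ∏ i, K (s i : ℕ) :=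
              Finset.prod_nonneg fun i _ => (hKpos _ (h.1 i)).le
            have h1 : Real.exp ((k : ℝ) * u) ≤ 1 :=
              Real.exp_le_one_iff.2 (mul_nonpos_of_nonneg_of_nonpos (Nat.cast_nonneg k) hu)
            exact mul_le_of_le_one_left h0 h1
          · exact Finset.prod_nonneg fun i _ => hg _
      _ = (∑ x : Fin (N + 1), (if 1 ≤ (x : ℕ) then K (x : ℕ) else 0)) ^ k := by
          rw [Fintype.sum_pow]
      _ ≤ 1 := pow_le_one₀ (Finset.sum_nonneg fun x _ => hg _) (aux_partial_le K hKpos hs N)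
  calc _ ≤ ∑ k ∈ Finset.Icc 1 N, (1 : ℝ) := Finset.sum_le_sum key
    _ = N := by simp

theorem aux_lower_k (K : ℕ → ℝ) (hKpos : ∀ n, 1 ≤ n → 0 < K n) (u : ℝ) (N k M : ℕ)
    (hk : 1 ≤ k) (hkN : k ≤ N) :
    ∑ t ∈ (Fintype.piFinset (fun _ : Fin k => Finset.Icc 1 M)).filter (fun t => ∑ i, t i = N),
      Real.exp ((k : ℝ) * u) * ∏ i, K (t i) ≤ Zhom K u N := by
  rw [Zhom, if_neg (by omega)]
  refine le_trans ?_ (Finset.single_le_sum (f := fun k => ∑ s : Fin k → Fin (N + 1),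
      if (∀ i, 1 ≤ (s i : ℕ)) ∧ (∑ i, (s i : ℕ)) = N then
        Real.exp ((k : ℝ) * u) * ∏ i, K (s i : ℕ) else 0)
    (fun k _ => Finset.sum_nonneg fun s _ => aux_term_nonneg K hKpos u N k s)
    (Finset.mem_Icc.2 ⟨hk, hkN⟩))
  let e : (Fin k → Fin (N + 1)) → (Fin k → ℕ) := fun s i => (s i : ℕ)
  have he : Function.Injective e := by
    intro a b h
    funext i
    exact Fin.ext (congrFun h i)
  let g : (Fin k → ℕ) → ℝ := fun t => if (∀ i, 1 ≤ t i) ∧ (∑ i, t i) = N then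
        Real.exp ((k : ℝ) * u) * ∏ i, K (t i) else 0
  have hg : ∀ t, 0 ≤ g t := by
    intro t
    simp only [g]
    split_ifs with h
    · exact mul_nonneg (Real.exp_pos _).le (Finset.prod_nonneg fun i _ => (hKpos _ (h.1 i)).le)
    · exact le_rfl
  have h1 : ∑ t ∈ Finset.univ.image e, g t = ∑ s, g (e s) :=
    Finset.sum_image (fun a _ b _ h => he h)
  change _ ≤ ∑ s, g (e s)
  rw [← h1]
  calc _ = ∑ t ∈ (Fintype.piFinset (fun _ : Fin k => Finset.Icc 1 M)).filter
        (fun t => ∑ i, t i = N), g t := by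
        refine Finset.sum_congr rfl fun t ht => ?_
        rw [Finset.mem_filter, Fintype.mem_piFinset] at ht
        simp only [g]
        rw [if_pos ⟨fun i => (Finset.mem_Icc.1 (ht.1 i)).1, ht.2⟩]
    _ ≤ _ := by
        refine Finset.sum_le_sum_of_subset_of_nonneg ?_ fun t _ _ => hg t
        intro t ht
        rw [Finset.mem_filter] at ht
        have hle : ∀ i, t i ≤ N := fun i => by
          rw [← ht.2]
          exact Finset.single_le_sum (f := t) (fun _ _ => Nat.zero_le _) (Finset.mem_univ i)
        refine Finset.mem_image.2 ⟨fun i => ⟨t i, Nat.lt_succ_of_le (hle i)⟩, Finset.mem_univ _, ?_⟩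
        rfl

theorem aux_pow_le (K : ℕ → ℝ) (hKpos : ∀ n, 1 ≤ n → 0 < K n) (u b : ℝ) (k M : ℕ)
    (hk : 1 ≤ k) :
    (∑ n ∈ Finset.Icc 1 M, Real.exp (u - b * n) * K n) ^ k ≤
      ∑ N ∈ Finset.Icc k (k * M), Real.exp (-(b * N)) * Zhom K u N := by
  have h1 : (∑ n ∈ Finset.Icc 1 M, Real.exp (u - b * n) * K n) ^ k =
      ∑ t ∈ Fintype.piFinset (fun _ : Fin k => Finset.Icc 1 M),
        ∏ i, (Real.exp (u - b * (t i : ℕ)) * K (t i)) := by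
    rw [← Finset.prod_univ_sum (fun _ : Fin k => Finset.Icc 1 M)
      (fun _ n => Real.exp (u - b * (n : ℕ)) * K n)]
    simp
  have hm : ∀ t ∈ Fintype.piFinset (fun _ : Fin k => Finset.Icc 1 M),
      (∑ i, t i) ∈ Finset.Icc k (k * M) := by
    intro t ht
    rw [Fintype.mem_piFinset] at ht
    rw [Finset.mem_Icc]
    constructor
    · calc k = ∑ i : Fin k, 1 := by simp
        _ ≤ _ := Finset.sum_le_sum fun i _ => (Finset.mem_Icc.1 (ht i)).1
    · calc _ ≤ ∑ i : Fin k, M := Finset.sum_le_sum fun i _ => (Finset.mem_Icc.1 (ht i)).2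
        _ = k * M := by simp
  rw [h1, ← Finset.sum_fiberwise_of_maps_to hm]
  refine Finset.sum_le_sum fun N hN => ?_
  rw [Finset.mem_Icc] at hN
  refine le_trans (le_of_eq ?_) (mul_le_mul_of_nonneg_left
    (aux_lower_k K hKpos u N k M hk hN.1) (Real.exp_pos _).le)
  rw [Finset.mul_sum]
  refine Finset.sum_congr rfl fun t ht => ?_
  rw [Finset.mem_filter] at ht
  rw [Finset.prod_mul_distrib, ← Real.exp_sum, ← mul_assoc, ← Real.exp_add]
  congr 2
  rw [Finset.sum_sub_distrib, ← Finset.mul_sum, ← ht.2]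
  simp
  ring

theorem aux_pos (K : ℕ → ℝ) (hKpos : ∀ n, 1 ≤ n → 0 < K n)
    (hs : HasSum (fun n => K (n + 1)) 1) (F u : ℝ) (hu : 0 < u)
    (hF : Tendsto (fun N : ℕ => Real.log (Zhom K u N) / N) atTop (𝓝 F)) : 0 < F := by
  have hexp : 1 < Real.exp u := Real.one_lt_exp_iff.2 hu
  have ht : Tendsto (fun M : ℕ => Real.exp u * ∑ n ∈ Finset.range M, K (n + 1)) atTop
      (𝓝 (Real.exp u * 1)) := hs.tendsto_sum_nat.const_mul _
  rw [mul_one] at ht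
  obtain ⟨M, hA, hM⟩ := ((ht.eventually (lt_mem_nhds hexp)).and (eventually_ge_atTop 1)).exists
  set A := Real.exp u * ∑ n ∈ Finset.range M, K (n + 1) with hAdef
  have hsum : ∑ n ∈ Finset.range M, K (n + 1) = ∑ n ∈ Finset.Icc 1 M, K n := by
    rw [Finset.range_eq_Ico, Finset.sum_Ico_add' K 0 M 1]
    rfl
  have hM0 : (0 : ℝ) < M := by exact_mod_cast hM
  set b := Real.log A / M with hb
  have hbpos : 0 < b := div_pos (Real.log_pos hA) hM0
  have hone : 1 ≤ ∑ n ∈ Finset.Icc 1 M, Real.exp (u - b * n) * K n := by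
    have hAA : Real.exp (-(b * M)) * A = 1 := by
      have : b * M = Real.log A := by rw [hb]; field_simp
      rw [this, Real.exp_neg, Real.exp_log (by linarith)]
      exact inv_mul_cancel₀ (by linarith)
    rw [← hAA, hAdef, hsum, ← mul_assoc, ← Real.exp_add, Finset.mul_sum]
    refine Finset.sum_le_sum fun n hn => ?_
    rw [Finset.mem_Icc] at hn
    refine mul_le_mul_of_nonneg_right (Real.exp_le_exp.2 ?_) (hKpos n hn.1).le
    have : (n : ℝ) ≤ M := by exact_mod_cast hn.2
    nlinarith
  by_contra hneg
  push Not at hneg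
  have hev := hF.eventually (gt_mem_nhds (show F < b / 2 by linarith))
  obtain ⟨N0, hN0⟩ := eventually_atTop.1 hev
  have hZ : ∀ N, N0 ≤ N → 1 ≤ N → Zhom K u N ≤ Real.exp (b / 2 * N) := by
    intro N h1 h2
    have hNp : (0 : ℝ) < N := by exact_mod_cast h2
    have hZpos : 0 < Zhom K u N :=
      lt_of_lt_of_le (mul_pos (Real.exp_pos _) (hKpos N h2)) (aux_lower_one K hKpos u N h2)
    have := hN0 N h1
    rw [div_lt_iff₀ hNp] at this
    exact ((Real.log_lt_iff_lt_exp hZpos).1 this).le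
  set r := Real.exp (-(b / 2)) with hr
  have hr0 : 0 < r := Real.exp_pos _
  have hr1 : r < 1 := Real.exp_lt_one_iff.2 (by linarith)
  have hlim : Tendsto (fun k : ℕ => (M : ℝ) * ((k : ℝ) * r ^ k) + r ^ k) atTop (𝓝 (M * 0 + 0)) :=
    ((tendsto_self_mul_const_pow_of_lt_one hr0.le hr1).const_mul _).add
      (tendsto_pow_atTop_nhds_zero_of_lt_one hr0.le hr1)
  have hlt := hlim.eventually (gt_mem_nhds (show (M : ℝ) * 0 + 0 < 1 by simp))
  obtain ⟨k, hk1, hk2, hk3⟩ :=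
    (hlt.and ((eventually_ge_atTop 1).and (eventually_ge_atTop N0))).exists
  have h1 := one_le_pow₀ hone (n := k)
  have h2 := aux_pow_le K hKpos u b k M hk2
  have h3 : ∑ N ∈ Finset.Icc k (k * M), Real.exp (-(b * N)) * Zhom K u N ≤
      ∑ N ∈ Finset.Icc k (k * M), r ^ k := by
    refine Finset.sum_le_sum fun N hN => ?_
    rw [Finset.mem_Icc] at hN
    calc _ ≤ Real.exp (-(b * N)) * Real.exp (b / 2 * N) :=
          mul_le_mul_of_nonneg_left (hZ N (by omega) (by omega)) (Real.exp_pos _).le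
      _ = r ^ N := by
          rw [hr, ← Real.exp_add, ← Real.exp_nat_mul]
          congr 1
          ring
      _ ≤ r ^ k := pow_le_pow_of_le_one hr0.le hr1.le hN.1
  have h4 : ∑ N ∈ Finset.Icc k (k * M), r ^ k ≤ (M : ℝ) * ((k : ℝ) * r ^ k) + r ^ k := by
    rw [Finset.sum_const, nsmul_eq_mul, Nat.card_Icc]
    have : ((k * M + 1 - k : ℕ) : ℝ) ≤ ((k * M + 1 : ℕ) : ℝ) := by
      exact_mod_cast Nat.sub_le _ _
    push_cast at this
    have := mul_le_mul_of_nonneg_right this (pow_pos hr0 k).le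
    linarith
  linarith

theorem aux_K_two_pow (α : ℝ) (L K : ℕ → ℝ)
    (hL : ∀ c : ℝ, 0 < c →
      Tendsto (fun n : ℕ => L ⌊c * (n : ℝ)⌋₊ / L n) atTop (𝓝 1))
    (hKL : ∀ n : ℕ, 1 ≤ n → K n = L n * (n : ℝ) ^ (-(1 + α)))
    (hKpos : ∀ n, 1 ≤ n → 0 < K n) :
    ∃ a c : ℝ, ∀ᶠ m : ℕ in atTop, a + c * m ≤ Real.log (K (2 ^ m)) := by
  have h := hL 2 two_pos
  obtain ⟨n0, hn0⟩ := eventually_atTop.1 (h.eventually (lt_mem_nhds (show (1 / 2 : ℝ) < 1 by norm_num)))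
  set q : ℝ := 1 / 2 * (2 : ℝ) ^ (-(1 + α)) with hq
  have hqpos : 0 < q := by positivity
  have hstep : ∀ n : ℕ, n0 ≤ n → 1 ≤ n → q * K n ≤ K (2 * n) := by
    intro n h1 h2
    have hn := hn0 n h1
    have hfl : ⌊(2 : ℝ) * (n : ℝ)⌋₊ = 2 * n := by
      rw [show (2 : ℝ) * (n : ℝ) = ((2 * n : ℕ) : ℝ) by push_cast; rfl, Nat.floor_natCast]
    rw [hfl] at hn
    have hnp : (0 : ℝ) < n := by exact_mod_cast h2
    have hpw : 0 < (n : ℝ) ^ (-(1 + α)) := Real.rpow_pos_of_pos hnp _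
    have hLp : 0 < L n := by
      have := hKpos n h2
      rw [hKL n h2] at this
      exact (pos_iff_pos_of_mul_pos this).2 hpw
    rw [lt_div_iff₀ hLp] at hn
    rw [hKL n h2, hKL (2 * n) (by omega)]
    push_cast
    rw [Real.mul_rpow two_pos.le hnp.le, hq]
    have h2p : 0 < (2 : ℝ) ^ (-(1 + α)) := Real.rpow_pos_of_pos two_pos _
    have := mul_le_mul_of_nonneg_right hn.le (mul_pos h2p hpw).le
    linarith
  refine ⟨Real.log (K (2 ^ n0)) - n0 * Real.log q, Real.log q, ?_⟩
  refine eventually_atTop.2 ⟨n0, fun m hm => ?_⟩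
  induction m, hm using Nat.le_induction with
  | base => linarith
  | succ m hm ih =>
    have hge : n0 ≤ 2 ^ m := hm.trans Nat.lt_two_pow_self.le
    have h1 := hstep (2 ^ m) hge Nat.one_le_two_pow
    have hKp := hKpos (2 ^ m) Nat.one_le_two_pow
    have h2 := Real.log_le_log (mul_pos hqpos hKp) h1
    rw [Real.log_mul hqpos.ne' hKp.ne'] at h2
    rw [pow_succ, mul_comm]
    push_cast
    have e : K (2 * 2 ^ m) = K (2 ^ m * 2) := by rw [mul_comm]
    first
      | linarith
      | (rw [e] at h2; linarith)

theorem aux_zero (α : ℝ) (L K : ℕ → ℝ)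
    (hL : ∀ c : ℝ, 0 < c →
      Tendsto (fun n : ℕ => L ⌊c * (n : ℝ)⌋₊ / L n) atTop (𝓝 1))
    (hKL : ∀ n : ℕ, 1 ≤ n → K n = L n * (n : ℝ) ^ (-(1 + α)))
    (hKpos : ∀ n, 1 ≤ n → 0 < K n)
    (hs : HasSum (fun n => K (n + 1)) 1) (F u : ℝ) (hu : u ≤ 0)
    (hF : Tendsto (fun N : ℕ => Real.log (Zhom K u N) / N) atTop (𝓝 F)) : F = 0 := by
  have hZpos : ∀ N, 1 ≤ N → 0 < Zhom K u N := fun N h2 =>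
    lt_of_lt_of_le (mul_pos (Real.exp_pos _) (hKpos N h2)) (aux_lower_one K hKpos u N h2)
  apply le_antisymm
  · have hlog : Tendsto (fun N : ℕ => Real.log (N : ℝ) / (N : ℝ)) atTop (𝓝 0) := by
      have := (Real.isLittleO_log_id_atTop.tendsto_div_nhds_zero).comp
        (tendsto_natCast_atTop_atTop (R := ℝ))
      exact this
    refine le_of_tendsto_of_tendsto hF hlog ?_
    filter_upwards [eventually_ge_atTop 1] with N hN
    exact div_le_div_of_nonneg_right
      (Real.log_le_log (hZpos N hN) (aux_upper K hKpos hs u hu N hN)) (Nat.cast_nonneg N)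
  · obtain ⟨a, c, hac⟩ := aux_K_two_pow α L K hL hKL hKpos
    have h2 : Tendsto (fun m : ℕ => 2 ^ m : ℕ → ℕ) atTop atTop :=
      tendsto_pow_atTop_atTop_of_one_lt one_lt_two
    have hsub := hF.comp h2
    have hlim : Tendsto (fun m : ℕ => (u + a) * (1 / 2 : ℝ) ^ m + c * ((m : ℝ) * (1 / 2 : ℝ) ^ m))
        atTop (𝓝 ((u + a) * 0 + c * 0)) :=
      ((tendsto_pow_atTop_nhds_zero_of_lt_one (by norm_num) (by norm_num)).const_mul _).add
        ((tendsto_self_mul_const_pow_of_lt_one (by norm_num) (by norm_num)).const_mul _)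
    rw [show (u + a) * 0 + c * 0 = 0 by ring] at hlim
    refine le_of_tendsto_of_tendsto hlim hsub ?_
    filter_upwards [hac] with m hm
    have h1 : (1 : ℕ) ≤ 2 ^ m := Nat.one_le_two_pow
    have h3 := Real.log_le_log (mul_pos (Real.exp_pos u) (hKpos _ h1))
      (aux_lower_one K hKpos u (2 ^ m) h1)
    rw [Real.log_mul (Real.exp_pos u).ne' (hKpos _ h1).ne', Real.log_exp] at h3
    have hp : (0 : ℝ) < 2 ^ m := by positivity
    simp only [Function.comp]
    push_cast
    rw [le_div_iff₀ hp]
    have e : (1 / 2 : ℝ) ^ m * 2 ^ m = 1 := by rw [← mul_pow]; norm_num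
    calc _ = (u + a + c * m) * ((1 / 2 : ℝ) ^ m * 2 ^ m) := by ring
      _ = u + a + c * m := by rw [e, mul_one]
      _ ≤ _ := by linarith

/-- The homogeneous pinning model with recurrent interarrival
law has critical point zero: `F(u) = 0` for `u ≤ 0` and `F(u) > 0` for `u > 0`. -/
theorem statement17 (α : ℝ) (hα : 0 ≤ α) (L K : ℕ → ℝ)
    (hL : ∀ c : ℝ, 0 < c →
      Tendsto (fun n : ℕ => L ⌊c * (n : ℝ)⌋₊ / L n) atTop (𝓝 1))
    (hKL : ∀ n : ℕ, 1 ≤ n → K n = L n * (n : ℝ) ^ (-(1 + α)))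
    (hKpos : ∀ n, 1 ≤ n → 0 < K n) (hKsum : ∑' n : ℕ, K (n + 1) = 1)
    (F : ℝ → ℝ)
    (hF : ∀ u : ℝ, Tendsto (fun N : ℕ => Real.log (Zhom K u N) / N) atTop (𝓝 (F u))) :
    (∀ u : ℝ, u ≤ 0 → F u = 0) ∧ (∀ u : ℝ, 0 < u → 0 < F u) := by
  have hsm : Summable (fun n : ℕ => K (n + 1)) := by
    by_contra h
    rw [tsum_eq_zero_of_not_summable h] at hKsum
    exact zero_ne_one hKsum
  have hs : HasSum (fun n : ℕ => K (n + 1)) 1 := hKsum ▸ hsm.hasSum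
  exact ⟨fun u hu => aux_zero α L K hL hKL hKpos hs (F u) u hu (hF u),
    fun u hu => aux_pos K hKpos hs (F u) u hu (hF u)⟩
end
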